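/- Let X = Spec ℂ[x,y]/(y² − x²(x+1)) be the nodal cubic curve, let ν : 𝔸¹ → X be the normalization morphism given by t ↦ (t² − 1, t(t² − 1)), and let p : 𝔸¹ ∖ {−1} → X be the restriction of ν to the complement of the closed point −1. Then p is surjective and submersive, but p is not universally submersive: the base change of p along ν (the projection from the fibre product 𝔸¹ ×_X (𝔸¹ ∖ {−1}) to 𝔸¹) is not submersive and fails the curve covering property. -/

import Mathlib

open AlgebraicGeometry CategoryTheory CategoryTheory.Limits Polynomial

universe u

noncomputable section

/-- A curve in a scheme: a closed irreducible subset of topological Krull dimension 1. -/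
def IsIrreducibleCurve {X : Scheme.{u}} (C : Set X) : Prop :=
  IsClosed C ∧ IsIrreducible C ∧ topologicalKrullDim C = 1

/-- The curve covering property for a morphism of schemes. -/
def CurveCoveringProperty {X Y : Scheme.{u}} (p : X ⟶ Y) : Prop :=
  ∀ C : Set Y, IsIrreducibleCurve C → ∀ y ∈ C, IsClosed ({y} : Set Y) →
    ∃ C' : Set X, IsIrreducibleCurve C' ∧ y ∈ p.base '' C' ∧
      p.base '' C' ⊆ C ∧ C ⊆ closure (p.base '' C')

/-- The defining equation `y² - x²(x+1)` of the nodal cubic. -/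
def nodalRel : MvPolynomial (Fin 2) ℂ :=
  (MvPolynomial.X 1) ^ 2 - (MvPolynomial.X 0) ^ 2 * (MvPolynomial.X 0 + 1)

/-- The coordinate ring `ℂ[x,y]/(y² - x²(x+1))` of the nodal cubic. -/
abbrev NodalRing : Type :=
  MvPolynomial (Fin 2) ℂ ⧸ Ideal.span {nodalRel}

/-- The ring homomorphism `ℂ[x,y] → ℂ[t]`, `x ↦ t² - 1`, `y ↦ t(t² - 1)`. -/
def preNu : MvPolynomial (Fin 2) ℂ →+* Polynomial ℂ :=
  (MvPolynomial.aeval ![X ^ 2 - 1, X * (X ^ 2 - 1)]).toRingHom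

lemma preNu_nodalRel : preNu nodalRel = 0 := by
  simp only [preNu, nodalRel, AlgHom.toRingHom_eq_coe, RingHom.coe_coe, map_sub, map_pow,
    map_mul, map_add, map_one, MvPolynomial.aeval_X, Matrix.cons_val_zero, Matrix.cons_val_one,
    Matrix.head_cons]
  ring

/-- The normalization map on coordinate rings, `ℂ[x,y]/(y² - x²(x+1)) → ℂ[t]`. -/
def nuRing : NodalRing →+* Polynomial ℂ :=
  Ideal.Quotient.lift (Ideal.span {nodalRel}) preNu (by
    intro a ha
    obtain ⟨b, rfl⟩ := Ideal.mem_span_singleton'.mp ha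
    rw [map_mul, preNu_nodalRel, mul_zero])

/-- The coordinate ring `ℂ[t][1/(t+1)]` of `𝔸¹ ∖ {-1}`. -/
abbrev PuncturedLineRing : Type := Localization.Away (X + C 1 : Polynomial ℂ)

/-- The nodal cubic curve `X = Spec ℂ[x,y]/(y² - x²(x+1))`. -/
def NodalCurve : Scheme := Spec (CommRingCat.of NodalRing)

/-- The normalization `ν : 𝔸¹ → X`, `t ↦ (t² - 1, t(t² - 1))`. -/
def nu : Spec (CommRingCat.of (Polynomial ℂ)) ⟶ NodalCurve :=
  Spec.map (CommRingCat.ofHom nuRing)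

/-- The restriction `p : 𝔸¹ ∖ {-1} → X` of `ν`. -/
def pRestr : Spec (CommRingCat.of PuncturedLineRing) ⟶ NodalCurve :=
  Spec.map (CommRingCat.ofHom
    ((algebraMap (Polynomial ℂ) PuncturedLineRing).comp nuRing))

/-- The base change of `p` along `ν`: the projection
`𝔸¹ ×_X (𝔸¹ ∖ {-1}) → 𝔸¹`. -/
def baseChangeOfP :
    pullback nu pRestr ⟶ Spec (CommRingCat.of (Polynomial ℂ)) :=
  pullback.fst nu pRestr

lemma nuRing_mk (f : MvPolynomial (Fin 2) ℂ) :
    nuRing (Ideal.Quotient.mk _ f) = preNu f := rfl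

/-- The class of `x` in the nodal ring. -/
def nx : NodalRing := Ideal.Quotient.mk _ (MvPolynomial.X 0)
/-- The class of `y` in the nodal ring. -/
def ny : NodalRing := Ideal.Quotient.mk _ (MvPolynomial.X 1)

lemma nuRing_nx : nuRing nx = X ^ 2 - 1 := by
  simp [nx, nuRing_mk, preNu]

lemma nuRing_ny : nuRing ny = X * (X ^ 2 - 1) := by
  simp [ny, nuRing_mk, preNu]

lemma nuRing_const (c : ℂ) : nuRing (algebraMap ℂ NodalRing c) = C c := by
  have : algebraMap ℂ NodalRing c = Ideal.Quotient.mk _ (MvPolynomial.C c) := rfl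
  rw [this, nuRing_mk]
  simp [preNu]

lemma ny_sq : ny ^ 2 = nx ^ 2 * (nx + 1) := by
  have h : Ideal.Quotient.mk (Ideal.span {nodalRel}) nodalRel = 0 :=
    Ideal.Quotient.eq_zero_iff_mem.mpr (Ideal.mem_span_singleton_self _)
  have h2 : ny ^ 2 - nx ^ 2 * (nx + 1) = 0 := by
    exact h
  exact sub_eq_zero.mp h2

lemma normal_form (r : NodalRing) : ∃ a b : ℂ[X], r = aeval nx a + aeval nx b * ny := by
  obtain ⟨f, rfl⟩ := Ideal.Quotient.mk_surjective r
  induction f using MvPolynomial.induction_on with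
  | C c => exact ⟨C c, 0, by simp; rfl⟩
  | add p q hp hq =>
    obtain ⟨a, b, h⟩ := hp
    obtain ⟨a', b', h'⟩ := hq
    exact ⟨a + a', b + b', by rw [map_add, h, h']; simp only [map_add]; ring⟩
  | mul_X p i hp =>
    obtain ⟨a, b, h⟩ := hp
    rw [map_mul, h]
    fin_cases i
    · refine ⟨a * X, b * X, ?_⟩
      change _ * nx = _
      simp only [map_mul, aeval_X]; ring
    · refine ⟨b * (X ^ 2 * (X + 1)), a, ?_⟩
      change _ * ny = _
      simp only [map_mul, map_add, map_pow, map_one, aeval_X]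
      linear_combination (aeval nx b) * ny_sq

lemma nuRing_aeval (a : ℂ[X]) : nuRing (aeval nx a) = a.comp (X ^ 2 - 1) := by
  induction a using Polynomial.induction_on' with
  | add p q hp hq => simp [hp, hq]
  | monomial n c =>
    rw [aeval_monomial, map_mul, map_pow, nuRing_nx, nuRing_const, monomial_comp]

lemma comp_zero {a : ℂ[X]} (h : a.comp (X ^ 2 - 1) = 0) : a = 0 := by
  rcases Polynomial.comp_eq_zero_iff.mp h with h | h
  · exact h
  · exfalso
    have := congrArg (fun q : ℂ[X] => q.coeff 2) h.2
    simp [coeff_X_pow, coeff_one, coeff_C] at this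

lemma nuRing_injective : Function.Injective nuRing := by
  rw [injective_iff_map_eq_zero]
  intro r hr
  obtain ⟨a, b, rfl⟩ := normal_form r
  rw [map_add, map_mul, nuRing_aeval, nuRing_aeval, nuRing_ny] at hr
  have h2 := congrArg (fun q : ℂ[X] => q.comp (-X)) hr
  simp only [add_comp, mul_comp, comp_assoc, sub_comp, X_comp, one_comp, pow_comp, Polynomial.zero_comp,
    neg_sq] at h2
  have ha : a.comp (X ^ 2 - 1) = 0 := by
    have : (2 : ℂ[X]) * a.comp (X ^ 2 - 1) = 0 := by linear_combination hr + h2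
    simpa using this
  have hb : b.comp (X ^ 2 - 1) = 0 := by
    rw [ha, zero_add] at hr
    have hx : (X * (X ^ 2 - 1) : ℂ[X]) ≠ 0 := by
      refine mul_ne_zero X_ne_zero ?_
      exact X_pow_sub_C_ne_zero (by norm_num) (1 : ℂ)
    exact (mul_eq_zero.mp hr).resolve_right hx
  rw [comp_zero ha, comp_zero hb]; simp

lemma nuRing_isIntegral : nuRing.IsIntegral := by
  intro f
  have hX : nuRing.IsIntegralElem X := by
    refine ⟨X ^ 2 - C (nx + 1), monic_X_pow_sub_C _ (by norm_num), ?_⟩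
    simp [nuRing_nx]
  induction f using Polynomial.induction_on' with
  | add p q hp hq => exact hp.add _ hq
  | monomial n c =>
    rw [← C_mul_X_pow_eq_monomial, ← nuRing_const]
    refine (nuRing.isIntegralElem_map).mul _ ?_
    letI := nuRing.toAlgebra
    exact IsIntegral.pow (R := NodalRing) hX n

lemma eval_nuRing (r : NodalRing) : (nuRing r).eval 1 = (nuRing r).eval (-1) := by
  obtain ⟨a, b, rfl⟩ := normal_form r
  simp [nuRing_aeval, nuRing_ny]

/-- The closed point of the affine line given by a complex number. -/
def linePt (c : ℂ) : PrimeSpectrum ℂ[X] :=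
  PrimeSpectrum.comap (evalRingHom c) ⊥

lemma mem_linePt {c : ℂ} {f : ℂ[X]} : f ∈ (linePt c).asIdeal ↔ f.eval c = 0 := by
  simp [linePt]

lemma eq_linePt {Q : PrimeSpectrum ℂ[X]} (h : X + C 1 ∈ Q.asIdeal) : Q = linePt (-1) := by
  symm
  apply PrimeSpectrum.ext
  have hmax : (linePt (-1)).asIdeal.IsMaximal :=
    Ideal.comap_isMaximal_of_surjective (K := (⊥ : Ideal ℂ)) (evalRingHom (-1 : ℂ)) (fun c => ⟨C c, by simp⟩)
  refine hmax.eq_of_le Q.2.ne_top ?_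
  intro f hf
  rw [mem_linePt] at hf
  have : X - C (-1) ∣ f := dvd_iff_isRoot.mpr hf
  exact Ideal.mem_of_dvd _ this (by simpa using h)

lemma comap_linePt :
    PrimeSpectrum.comap nuRing (linePt 1) = PrimeSpectrum.comap nuRing (linePt (-1)) := by
  ext r
  change nuRing r ∈ (linePt 1).asIdeal ↔ nuRing r ∈ (linePt (-1)).asIdeal
  rw [mem_linePt, mem_linePt, eval_nuRing]

lemma mem_U {Q : PrimeSpectrum ℂ[X]} (h : X + C 1 ∉ Q.asIdeal) :
    ∃ R : PrimeSpectrum PuncturedLineRing,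
      PrimeSpectrum.comap (algebraMap ℂ[X] PuncturedLineRing) R = Q := by
  have : Q ∈ Set.range (PrimeSpectrum.comap (algebraMap ℂ[X] PuncturedLineRing)) := by
    rw [PrimeSpectrum.localization_away_comap_range PuncturedLineRing (X + C 1 : ℂ[X])]
    exact h
  exact this

lemma not_mem_U (R : PrimeSpectrum PuncturedLineRing) :
    X + C 1 ∉ (PrimeSpectrum.comap (algebraMap ℂ[X] PuncturedLineRing) R).asIdeal := by
  have : PrimeSpectrum.comap (algebraMap ℂ[X] PuncturedLineRing) R ∈
      Set.range (PrimeSpectrum.comap (algebraMap ℂ[X] PuncturedLineRing)) := ⟨R, rfl⟩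
  rw [PrimeSpectrum.localization_away_comap_range PuncturedLineRing (X + C 1 : ℂ[X])] at this
  exact this

lemma one_mem_U : X + C 1 ∉ (linePt 1).asIdeal := by
  rw [mem_linePt]; simp

/-- The map of `p` on prime spectra. -/
def pMap (R : PrimeSpectrum PuncturedLineRing) : PrimeSpectrum NodalRing :=
  PrimeSpectrum.comap nuRing (PrimeSpectrum.comap (algebraMap ℂ[X] PuncturedLineRing) R)

lemma nu_surjective : Function.Surjective (PrimeSpectrum.comap nuRing) :=
  nuRing_isIntegral.comap_surjective nuRing_injective

lemma pMap_surjective : Function.Surjective pMap := by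
  intro P
  obtain ⟨Q, rfl⟩ := nu_surjective P
  by_cases h : X + C 1 ∈ Q.asIdeal
  · obtain ⟨R, hR⟩ := mem_U one_mem_U
    exact ⟨R, by rw [eq_linePt h, ← comap_linePt, ← hR]; rfl⟩
  · obtain ⟨R, hR⟩ := mem_U h
    exact ⟨R, by rw [← hR]; rfl⟩

lemma pMap_continuous : Continuous pMap :=
  (PrimeSpectrum.continuous_comap _).comp (PrimeSpectrum.continuous_comap _)

lemma pMap_isQuotientMap : Topology.IsQuotientMap pMap := by
  rw [Topology.isQuotientMap_iff_isClosed]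
  refine ⟨pMap_surjective, fun Z => ⟨fun h => h.preimage pMap_continuous, fun h => ?_⟩⟩
  have hnu : Topology.IsQuotientMap (PrimeSpectrum.comap nuRing) :=
    (PrimeSpectrum.isClosedMap_comap_of_isIntegral _ nuRing_isIntegral).isQuotientMap
      (PrimeSpectrum.continuous_comap _) nu_surjective
  rw [(Topology.isQuotientMap_iff_isClosed.mp hnu).2]
  have hemb := PrimeSpectrum.localization_away_isOpenEmbedding PuncturedLineRing
    (X + C 1 : ℂ[X])
  obtain ⟨W, hW, hWZ⟩ := hemb.isInducing.isClosed_iff.mp h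
  have key : ∀ Q : PrimeSpectrum ℂ[X], X + C 1 ∉ Q.asIdeal →
      (Q ∈ W ↔ PrimeSpectrum.comap nuRing Q ∈ Z) := by
    intro Q hQ
    obtain ⟨R, rfl⟩ := mem_U hQ
    exact Set.ext_iff.mp hWZ R
  obtain ⟨I, rfl⟩ := (PrimeSpectrum.isClosed_iff_zeroLocus_ideal W).mp hW
  obtain ⟨f, rfl⟩ := (IsPrincipalIdealRing.principal I).principal
  have hWf : ∀ Q : PrimeSpectrum ℂ[X],
      Q ∈ PrimeSpectrum.zeroLocus ((Submodule.span ℂ[X] {f} : Ideal ℂ[X]) : Set ℂ[X]) ↔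
        f ∈ Q.asIdeal := by
    intro Q
    rw [PrimeSpectrum.mem_zeroLocus]
    exact Ideal.span_singleton_le_iff_mem _
  simp only [hWf] at key
  by_cases hf : f = 0
  · convert isClosed_univ
    ext Q
    simp only [Set.mem_preimage, Set.mem_univ, iff_true]
    obtain ⟨R, hR⟩ := pMap_surjective (PrimeSpectrum.comap nuRing Q)
    rw [← hR]
    exact (key _ (not_mem_U R)).mp (by simp [hf])
  obtain ⟨g, hg, hgd⟩ := exists_eq_pow_rootMultiplicity_mul_and_not_dvd f hf (-1)
  have hX : (X - C (-1) : ℂ[X]) = X + C 1 := by simp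
  rw [hX] at hg hgd
  by_cases hm : PrimeSpectrum.comap nuRing (linePt (-1)) ∈ Z
  · convert PrimeSpectrum.isClosed_zeroLocus {(X + C 1) * g}
    ext Q
    rw [PrimeSpectrum.mem_zeroLocus, Set.singleton_subset_iff, Set.mem_preimage]
    by_cases hQ : X + C 1 ∈ Q.asIdeal
    · rw [eq_linePt hQ]
      refine iff_of_true hm ?_
      rw [← eq_linePt hQ]
      exact Ideal.mul_mem_right _ _ hQ
    · rw [← key Q hQ, SetLike.mem_coe, Q.2.mul_mem_iff_mem_or_mem, hg,
        Q.2.mul_mem_iff_mem_or_mem]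
      have : (X + C 1) ^ rootMultiplicity (-1) f ∉ Q.asIdeal := fun h => hQ (Q.2.mem_of_pow_mem _ h)
      tauto
  · convert PrimeSpectrum.isClosed_zeroLocus {g}
    ext Q
    rw [PrimeSpectrum.mem_zeroLocus, Set.singleton_subset_iff, Set.mem_preimage]
    by_cases hQ : X + C 1 ∈ Q.asIdeal
    · rw [eq_linePt hQ]
      refine iff_of_false hm ?_
      rw [SetLike.mem_coe, mem_linePt]
      intro h
      apply hgd
      rw [← hX]
      exact dvd_iff_isRoot.mpr h
    · rw [← key Q hQ, SetLike.mem_coe, hg, Q.2.mul_mem_iff_mem_or_mem]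
      have : (X + C 1) ^ rootMultiplicity (-1) f ∉ Q.asIdeal := fun h => hQ (Q.2.mem_of_pow_mem _ h)
      tauto

/-- Algebraic heart of the second half: the fibre over `-1` is a basic open set. -/
lemma fibre_iff {R : Type*} [CommRing R] (α : ℂ[X] →+* R) (β : PuncturedLineRing →+* R)
    (h : α.comp nuRing = (β.comp (algebraMap ℂ[X] PuncturedLineRing)).comp nuRing)
    (P : PrimeSpectrum R) :
    PrimeSpectrum.comap α P = linePt (-1) ↔
      α X - β (algebraMap ℂ[X] PuncturedLineRing X) ∉ P.asIdeal := by
  set u := α X with hu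
  set v := β (algebraMap ℂ[X] PuncturedLineRing X) with hv
  have e1 : u ^ 2 - 1 = v ^ 2 - 1 := by
    have := RingHom.congr_fun h nx
    simpa [nuRing_nx] using this
  have e2 : u * (u ^ 2 - 1) = v * (v ^ 2 - 1) := by
    have := RingHom.congr_fun h ny
    simpa [nuRing_ny] using this
  have hunit : IsUnit (v + 1) := by
    have h1 : IsUnit (algebraMap ℂ[X] PuncturedLineRing (X + C 1)) :=
      IsLocalization.Away.algebraMap_isUnit _
    have := h1.map β
    simpa using this
  have hv1 : v + 1 ∉ P.asIdeal := fun hm => P.2.ne_top (Ideal.eq_top_of_isUnit_mem _ hm hunit)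
  have h2 : (2 : R) ∉ P.asIdeal := by
    have : IsUnit (2 : R) := by
      have h1 : IsUnit (C (2 : ℂ)) := (IsUnit.mk0 (2 : ℂ) (by norm_num)).map C
      have h3 := h1.map α
      rwa [C_ofNat, map_ofNat] at h3
    exact fun hm => P.2.ne_top (Ideal.eq_top_of_isUnit_mem _ hm this)
  have hiff : PrimeSpectrum.comap α P = linePt (-1) ↔ u + 1 ∈ P.asIdeal := by
    constructor
    · intro h
      have : X + C 1 ∈ (PrimeSpectrum.comap α P).asIdeal := by
        rw [h, mem_linePt]; simp
      have h3 : α (X + C 1) ∈ P.asIdeal := this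
      simpa using h3
    · intro h
      apply eq_linePt
      change α (X + C 1) ∈ P.asIdeal
      simpa using h
  rw [hiff]
  constructor
  · intro hu1 huv
    have : v + 1 = (u + 1) - (u - v) := by ring
    exact hv1 (this ▸ P.asIdeal.sub_mem hu1 huv)
  · intro huv
    have hs : u + v ∈ P.asIdeal := by
      have : (u - v) * (u + v) ∈ P.asIdeal := by
        have : (u - v) * (u + v) = 0 := by linear_combination e1
        rw [this]; exact zero_mem _
      exact (P.2.mem_or_mem this).resolve_left huv
    have hp : (u + 1) * (v + 1) ∈ P.asIdeal := by
      have h0 : (u - v) * (v ^ 2 - 1) ∈ P.asIdeal := by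
        have : (u - v) * (v ^ 2 - 1) = 0 := by linear_combination e2 - u * e1
        rw [this]; exact zero_mem _
      have h4 := (P.2.mem_or_mem h0).resolve_left huv
      have : (u + 1) * (v + 1) = (u + v) * (v + 1) - (v ^ 2 - 1) := by ring
      rw [this]
      exact P.asIdeal.sub_mem (Ideal.mul_mem_right _ _ hs) h4
    exact (P.2.mem_or_mem hp).resolve_right hv1

instance : IsAffine NodalCurve := by unfold NodalCurve; infer_instance

lemma isOpen_fibre : IsOpen (baseChangeOfP.base ⁻¹' {linePt (-1)}) := by
  let Y := pullback nu pRestr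
  let e : Y ≅ Spec Γ(Y, ⊤) := Y.isoSpec
  let α := Spec.preimage (e.inv ≫ pullback.fst nu pRestr)
  let β := Spec.preimage (e.inv ≫ pullback.snd nu pRestr)
  have hα : Spec.map α = e.inv ≫ pullback.fst nu pRestr := Spec.map_preimage _
  have hβ : Spec.map β = e.inv ≫ pullback.snd nu pRestr := Spec.map_preimage _
  have hc : CommRingCat.ofHom nuRing ≫ α = CommRingCat.ofHom
    ((algebraMap (Polynomial ℂ) PuncturedLineRing).comp nuRing) ≫ β := by
    apply Spec.map_injective
    rw [Spec.map_comp, Spec.map_comp, hα, hβ, Category.assoc, Category.assoc]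
    congr 1
    exact pullback.condition
  have hc' : α.hom.comp nuRing =
      (β.hom.comp (algebraMap ℂ[X] PuncturedLineRing)).comp nuRing :=
    congrArg CommRingCat.Hom.hom hc
  have hfst : baseChangeOfP = e.hom ≫ Spec.map α := by
    rw [hα, Iso.hom_inv_id_assoc]; rfl
  have heq : baseChangeOfP.base ⁻¹' {linePt (-1)} = e.hom.base ⁻¹'
      (PrimeSpectrum.basicOpen
        (α.hom X - β.hom (algebraMap ℂ[X] PuncturedLineRing X)) : Set (PrimeSpectrum _)) := by
    rw [hfst]
    ext z
    exact fibre_iff α.hom β.hom hc' (e.hom.base z)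
  rw [heq]
  exact (PrimeSpectrum.basicOpen _).isOpen.preimage e.hom.continuous

lemma closed_linePt : IsClosed ({linePt (-1)} : Set (PrimeSpectrum ℂ[X])) := by
  convert PrimeSpectrum.isClosed_zeroLocus {(X + C 1 : ℂ[X])}
  ext Q
  rw [PrimeSpectrum.mem_zeroLocus, Set.singleton_subset_iff, Set.mem_singleton_iff]
  refine ⟨?_, fun h => eq_linePt h⟩
  rintro rfl
  rw [SetLike.mem_coe, mem_linePt]; simp

lemma linePt_ne : linePt 1 ≠ linePt (-1) := by
  intro h
  apply one_mem_U
  rw [h, mem_linePt]; simp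

lemma not_isOpen_linePt : ¬ IsOpen ({linePt (-1)} : Set (PrimeSpectrum ℂ[X])) := by
  intro h
  have hd := h.dense ⟨_, rfl⟩
  have := hd.closure_eq
  rw [closed_linePt.closure_eq] at this
  exact linePt_ne (this.symm ▸ Set.mem_univ (linePt 1) : linePt 1 ∈ ({linePt (-1)} : Set _))

lemma curve_univ :
    IsIrreducibleCurve (X := Spec (CommRingCat.of (Polynomial ℂ))) Set.univ := by
  refine ⟨isClosed_univ, IrreducibleSpace.isIrreducible_univ (PrimeSpectrum ℂ[X]), ?_⟩
  have h1 := IsHomeomorph.topologicalKrullDim_eq _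
    (Homeomorph.Set.univ (PrimeSpectrum ℂ[X])).isHomeomorph
  refine h1.trans ?_
  rw [PrimeSpectrum.topologicalKrullDim_eq_ringKrullDim]
  exact IsPrincipalIdealRing.ringKrullDim_eq_one ℂ[X] (Polynomial.not_isField ℂ)


/-- The restriction `p : 𝔸¹ ∖ {-1} → X` of the normalization `ν` of the nodal cubic is
surjective and submersive, but not universally submersive: its base change along `ν`
is not submersive and fails the curve covering property. -/
theorem nodal_cubic_not_universally_submersive :
    Function.Surjective pRestr.base ∧
    Topology.IsQuotientMap pRestr.base ∧
    ¬ Topology.IsQuotientMap baseChangeOfP.base ∧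
    ¬ CurveCoveringProperty baseChangeOfP := by
  refine ⟨pMap_surjective, pMap_isQuotientMap, ?_, ?_⟩
  · intro h
    exact not_isOpen_linePt (h.isOpen_preimage.mp isOpen_fibre)
  · intro h
    obtain ⟨C', hC', ⟨z, hz, hzy⟩, -, hdense⟩ :=
      h Set.univ curve_univ (linePt (-1)) (Set.mem_univ _) closed_linePt
    have hsub : C' ⊆ closure (C' ∩ baseChangeOfP.base ⁻¹' {linePt (-1)}) :=
      subset_closure_inter_of_isPreirreducible_of_isOpen hC'.2.1.isPreirreducible isOpen_fibre ⟨z, hz, hzy⟩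
    have hclosed : IsClosed (baseChangeOfP.base ⁻¹' {linePt (-1)}) :=
      closed_linePt.preimage baseChangeOfP.continuous
    have h1 : baseChangeOfP.base '' C' ⊆ {linePt (-1)} := by
      rintro _ ⟨w, hw, rfl⟩
      exact closure_minimal Set.inter_subset_right hclosed (hsub hw)
    have h2 := hdense.trans (closure_minimal h1 closed_linePt)
    exact linePt_ne (h2 (Set.mem_univ (linePt 1)))
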